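/- The limit lim_{d→1⁻} C(d)/(1−d) exists and equals inf_{d∈(0,1)} C(d)/(1−d). -/

import Mathlib

open scoped BigOperators

noncomputable section

/-- Output alphabet of the binary deletion channel with `n` input bits:
a length `k ≤ n` together with a binary string of that length. -/
abbrev DelOut (n : ℕ) := Σ k : Fin (n + 1), (Fin (k : ℕ) → Bool)

/-- The subsequence of `x` indexed by `S` (taken in increasing order),
as an element of `DelOut n`. -/
def restrictSub {n : ℕ} (x : Fin n → Bool) (S : Finset (Fin n)) : DelOut n :=
  ⟨⟨S.card, Nat.lt_succ_of_le (by simpa using Finset.card_le_univ S)⟩,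
   fun i => x (S.orderEmbOfFin rfl i)⟩

/-- Transition probability of the binary deletion channel `W_n^d`: each input bit is
deleted independently with probability `d`. -/
def delW {n : ℕ} (d : ℝ) (x : Fin n → Bool) (y : DelOut n) : ℝ :=
  ∑ S : Finset (Fin n),
    if restrictSub x S = y then (1 - d) ^ S.card * d ^ (n - S.card) else 0

/-- Transition probability of the exact deletion channel `W_{n,k}`, which keeps exactly `k`
of the `n` input bits, the kept positions being a uniformly random `k`-subset; `k`-subsets
are identified with strictly monotone maps `Fin k → Fin n`. -/
def exactW {n k : ℕ} (x : Fin n → Bool) (y : Fin k → Bool) : ℝ :=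
  ((Finset.univ.filter fun f : Fin k → Fin n => StrictMono f ∧ x ∘ f = y).card : ℝ) /
    (n.choose k : ℝ)

/-- `p` is a probability distribution on the finite alphabet `α`. -/
def IsDist {α : Type*} [Fintype α] (p : α → ℝ) : Prop :=
  (∀ a, 0 ≤ p a) ∧ ∑ a, p a = 1

/-- Base-2 mutual information `I(X;Y)` between the input `X ~ p` and the output `Y`
of the channel with transition matrix `W`. -/
def mutualInfo {α β : Type*} [Fintype α] [Fintype β] (p : α → ℝ) (W : α → β → ℝ) : ℝ :=
  ∑ x, ∑ y, p x * W x y * Real.logb 2 (W x y / ∑ x', p x' * W x' y)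

/-- `C_n(d) = (1/n) · sup_p I(X ; W_n^d(X))`. -/
def Cn (n : ℕ) (d : ℝ) : ℝ :=
  (1 / (n : ℝ)) * ⨆ p : {p : (Fin n → Bool) → ℝ // IsDist p}, mutualInfo p.1 (delW d)

/-- `C_{n,k} = (1/n) · sup_p I(X ; W_{n,k}(X))`. -/
def Cnk (n k : ℕ) : ℝ :=
  (1 / (n : ℝ)) * ⨆ p : {p : (Fin n → Bool) → ℝ // IsDist p},
    mutualInfo p.1 (exactW (n := n) (k := k))

/-- Capacity of the binary deletion channel: `C(d) = inf_{n ≥ 1} C_n(d)`. -/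
def C (d : ℝ) : ℝ := ⨅ n : {m : ℕ // 1 ≤ m}, Cn n d

/-! ### Relative entropy and the log-sum inequality -/

open Real in
lemma sub_le_mul_log_div {a b : ℝ} (ha : 0 ≤ a) (hb : 0 ≤ b) (hab : b = 0 → a = 0) :
    a - b ≤ a * log (a / b) := by
  rcases ha.eq_or_lt with rfl | ha
  · simpa using hb
  have hb : 0 < b := hb.lt_of_ne fun h => ha.ne' (hab h.symm)
  have h := one_sub_inv_le_log_of_pos (div_pos ha hb)
  calc a - b = a * (1 - (a / b)⁻¹) := by field_simp
    _ ≤ _ := mul_le_mul_of_nonneg_left h ha.le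

open Real in
lemma sum_mul_log_div_le {ι : Type*} (s : Finset ι) (a b : ι → ℝ) {B : ℝ}
    (ha : ∀ i ∈ s, 0 ≤ a i) (hb : ∀ i ∈ s, 0 ≤ b i) (hab : ∀ i ∈ s, b i = 0 → a i = 0)
    (hB : ∑ i ∈ s, b i ≤ B) :
    (∑ i ∈ s, a i) * log ((∑ i ∈ s, a i) / B) ≤ ∑ i ∈ s, a i * log (a i / b i) := by
  set A := ∑ i ∈ s, a i with hA
  rcases (Finset.sum_nonneg ha).eq_or_lt with h0 | hpos
  · have h := (Finset.sum_eq_zero_iff_of_nonneg ha).1 h0.symm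
    rw [hA, ← h0, Finset.sum_eq_zero fun i hi => by rw [h i hi, zero_mul]]
    simp
  have hBpos : 0 < B := by
    obtain ⟨i, hi, hne⟩ := Finset.exists_ne_zero_of_sum_ne_zero hpos.ne'
    have h1 : 0 < b i := (hb i hi).lt_of_ne fun h => hne (hab i hi h.symm)
    exact (h1.trans_le (Finset.single_le_sum hb hi)).trans_le hB
  have hr : 0 < A / B := div_pos hpos hBpos
  have key : ∀ i ∈ s, a i * log (A / B) + (a i - b i * (A / B)) ≤ a i * log (a i / b i) := by
    intro i hi
    have h := sub_le_mul_log_div (ha i hi) (mul_nonneg (hb i hi) hr.le)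
      (fun h => hab i hi ((mul_eq_zero.1 h).resolve_right hr.ne'))
    rcases (ha i hi).eq_or_lt with h0 | h0
    · rw [← h0] at h ⊢
      simpa using h
    have hbi : b i ≠ 0 := fun h => h0.ne' (hab i hi h)
    rw [← div_div, log_div (div_ne_zero h0.ne' hbi) hr.ne'] at h
    linarith
  have h := Finset.sum_le_sum key
  rw [Finset.sum_add_distrib, Finset.sum_sub_distrib, ← Finset.sum_mul, ← Finset.sum_mul] at h
  have h2 : (∑ i ∈ s, b i) * (A / B) ≤ A := by
    calc _ ≤ B * (A / B) := mul_le_mul_of_nonneg_right hB hr.le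
      _ = A := by field_simp
  linarith

/-- Relative entropy, in nats, of `w` with respect to `q`. -/
def relEnt {κ : Type*} (w : κ →₀ ℝ) (q : κ → ℝ) : ℝ :=
  w.sum fun y a => a * Real.log (a / q y)

lemma relEnt_eq_sum {κ : Type*} (w : κ →₀ ℝ) (q : κ → ℝ) {t : Finset κ} (h : w.support ⊆ t) :
    relEnt w q = ∑ y ∈ t, w y * Real.log (w y / q y) :=
  Finsupp.sum_of_support_subset _ h _ (by simp)

/-- Relative entropy does not increase under a map of the alphabet. -/
lemma relEnt_le_of_map {ι κ : Type*} [DecidableEq κ] (s : Finset ι) (f : ι → κ) (a b : ι → ℝ)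
    (ha : ∀ i ∈ s, 0 ≤ a i) (hb : ∀ i ∈ s, 0 ≤ b i) (hab : ∀ i ∈ s, b i = 0 → a i = 0)
    (w : κ →₀ ℝ) (q : κ → ℝ) (hw : ∀ y, w y = ∑ i ∈ s with f i = y, a i)
    (hq : ∀ y, ∑ i ∈ s with f i = y, b i ≤ q y) :
    relEnt w q ≤ ∑ i ∈ s, a i * Real.log (a i / b i) := by
  have hsupp : w.support ⊆ s.image f := by
    intro y hy
    rw [Finsupp.mem_support_iff, hw] at hy
    obtain ⟨i, hi, -⟩ := Finset.exists_ne_zero_of_sum_ne_zero hy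
    rw [Finset.mem_filter] at hi
    exact Finset.mem_image.2 ⟨i, hi⟩
  rw [relEnt_eq_sum w q hsupp,
    ← Finset.sum_fiberwise_of_maps_to (fun i hi => Finset.mem_image_of_mem f hi)]
  refine Finset.sum_le_sum fun y _ => ?_
  rw [hw]
  exact sum_mul_log_div_le _ a b (fun i hi => ha i (Finset.mem_filter.1 hi).1)
    (fun i hi => hb i (Finset.mem_filter.1 hi).1) (fun i hi => hab i (Finset.mem_filter.1 hi).1)
    (hq y)

/-- Convexity of the relative entropy in its first argument. -/
lemma relEnt_sum_le {ι κ : Type*} (s : Finset ι) (v : ι → ℝ) (w : ι → κ →₀ ℝ) (q : κ → ℝ)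
    (hv : ∀ i ∈ s, 0 ≤ v i) (hv1 : ∑ i ∈ s, v i = 1) (hw : ∀ i ∈ s, ∀ y, 0 ≤ w i y)
    (hq : ∀ y, 0 ≤ q y) (hwq : ∀ i ∈ s, ∀ y, w i y ≠ 0 → 0 < q y) :
    relEnt (∑ i ∈ s, v i • w i) q ≤ ∑ i ∈ s, v i * relEnt (w i) q := by
  classical
  set T := s.biUnion fun i => (w i).support with hT
  have hsub : ∀ i ∈ s, (w i).support ⊆ T := fun i hi =>
    Finset.subset_biUnion_of_mem (fun i => (w i).support) hi
  have hsupp : (∑ i ∈ s, v i • w i).support ⊆ T := by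
    refine Finsupp.support_finsetSum.trans ?_
    exact Finset.biUnion_mono fun i _ => Finsupp.support_smul
  rw [relEnt_eq_sum _ q hsupp]
  have : ∑ i ∈ s, v i * relEnt (w i) q
      = ∑ y ∈ T, ∑ i ∈ s, (v i * w i y) * Real.log ((v i * w i y) / (v i * q y)) := by
    rw [Finset.sum_comm]
    refine Finset.sum_congr rfl fun i hi => ?_
    rw [relEnt_eq_sum _ q (hsub i hi), Finset.mul_sum]
    refine Finset.sum_congr rfl fun y _ => ?_
    rcases eq_or_ne (v i) 0 with h | h
    · simp [h]
    · rw [mul_div_mul_left _ _ h, mul_assoc]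
  rw [this]
  refine Finset.sum_le_sum fun y _ => ?_
  have hsum : (∑ i ∈ s, v i • w i) y = ∑ i ∈ s, v i * w i y := by
    simp [Finsupp.finsetSum_apply]
  rw [hsum]
  refine sum_mul_log_div_le _ _ _ (fun i hi => mul_nonneg (hv i hi) (hw i hi y))
    (fun i hi => mul_nonneg (hv i hi) (hq y)) (fun i hi h => ?_) ?_
  · by_contra hne
    have h2 := mul_ne_zero_iff.1 hne
    exact mul_ne_zero h2.1 (hwq i hi y h2.2).ne' h
  · rw [← Finset.sum_mul, hv1, one_mul]

/-- Scaling the reference measure down by at most a factor `t`. -/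
lemma relEnt_le_add_log {κ : Type*} (w : κ →₀ ℝ) (q q' : κ → ℝ) {t : ℝ} (ht : 0 < t)
    (hw : ∀ y, 0 ≤ w y) (hw1 : (w.sum fun _ a => a) = 1) (hwq : ∀ y, w y ≠ 0 → 0 < q y)
    (hqq : ∀ y, q y ≤ t * q' y) :
    relEnt w q' ≤ relEnt w q + Real.log t := by
  have : Real.log t = w.sum fun _ a => a * Real.log t := by
    rw [Finsupp.sum, ← Finset.sum_mul]
    rw [Finsupp.sum] at hw1
    rw [hw1, one_mul]
  rw [this, relEnt, relEnt, ← Finsupp.sum_add]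
  refine Finset.sum_le_sum fun y hy => ?_
  have hwy : 0 < w y := (hw y).lt_of_ne (Finsupp.mem_support_iff.1 hy).symm
  have hqy := hwq y hwy.ne'
  have hq' : 0 < q' y := pos_of_mul_pos_right (hqy.trans_le (hqq y)) ht.le
  simp only []
  rw [← mul_add, ← Real.log_mul (div_pos hwy hqy).ne' ht.ne']
  refine mul_le_mul_of_nonneg_left (Real.log_le_log (div_pos hwy hq') ?_) hwy.le
  rw [div_mul_eq_mul_div, div_le_div_iff₀ hq' hqy]
  nlinarith [hqq y]

/-! ### Dual description of the capacity of a finite channel -/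

section Channel

variable {α β : Type*} [Fintype α] [Fintype β] {W : α → β → ℝ}

open Real in
lemma mutualInfo_mul_log_two (p : α → ℝ) (W : α → β → ℝ) :
    mutualInfo p W * log 2
      = ∑ x, ∑ y, p x * W x y * log (W x y / ∑ x', p x' * W x' y) := by
  have h2 : log 2 ≠ 0 := (log_pos one_lt_two).ne'
  simp only [mutualInfo, Finset.sum_mul, logb]
  refine Finset.sum_congr rfl fun x _ => Finset.sum_congr rfl fun y _ => ?_
  field_simp

open Real in
/-- Compensation identity: mutual information in terms of divergences from a positive `q`. -/
lemma mutualInfo_add_divergence (hW : ∀ x y, 0 ≤ W x y) {p : α → ℝ} (hp : IsDist p)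
    {q : β → ℝ} (hq : ∀ y, 0 < q y) :
    mutualInfo p W * log 2
        + ∑ y, (∑ x, p x * W x y) * log ((∑ x, p x * W x y) / q y)
      = ∑ x, p x * ∑ y, W x y * log (W x y / q y) := by
  have hterm : ∀ x y, p x * W x y * log (W x y / ∑ x', p x' * W x' y)
      + p x * W x y * log ((∑ x', p x' * W x' y) / q y)
      = p x * (W x y * log (W x y / q y)) := by
    intro x y
    rcases eq_or_ne (p x * W x y) 0 with h | h
    · rw [← mul_assoc, h]
      simp
    have h2 := mul_ne_zero_iff.1 h
    have hQ : (∑ x', p x' * W x' y) ≠ 0 := fun h0 => h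
      ((Finset.sum_eq_zero_iff_of_nonneg fun i _ => mul_nonneg (hp.1 i) (hW i y)).1 h0 x
        (Finset.mem_univ x))
    rw [log_div h2.2 hQ, log_div hQ (hq y).ne', log_div h2.2 (hq y).ne']
    ring
  rw [mutualInfo_mul_log_two]
  simp only [Finset.sum_mul, Finset.mul_sum]
  rw [Finset.sum_comm (s := (Finset.univ : Finset β)), ← Finset.sum_add_distrib]
  refine Finset.sum_congr rfl fun x _ => ?_
  rw [← Finset.sum_add_distrib]
  exact Finset.sum_congr rfl fun y _ => hterm x y

lemma sum_output_eq_one (hW1 : ∀ x, ∑ y, W x y = 1) {p : α → ℝ} (hp : IsDist p) :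
    ∑ y, ∑ x, p x * W x y = 1 := by
  rw [Finset.sum_comm]
  simp_rw [← Finset.mul_sum, hW1, mul_one]
  exact hp.2

open Real in
lemma mutualInfo_mul_log_two_le (hW : ∀ x y, 0 ≤ W x y) (hW1 : ∀ x, ∑ y, W x y = 1)
    {q : β → ℝ} (hq : ∀ y, 0 < q y) (hq1 : ∑ y, q y ≤ 1) {c : ℝ}
    (hc : ∀ x, ∑ y, W x y * log (W x y / q y) ≤ c) {p : α → ℝ} (hp : IsDist p) :
    mutualInfo p W * log 2 ≤ c := by
  have h1 := mutualInfo_add_divergence hW hp hq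
  have h2 := sum_mul_log_div_le Finset.univ (fun y => ∑ x, p x * W x y) q
    (fun y _ => Finset.sum_nonneg fun x _ => mul_nonneg (hp.1 x) (hW x y))
    (fun y _ => (hq y).le) (fun y _ h => absurd h (hq y).ne') hq1
  rw [sum_output_eq_one hW1 hp] at h2
  have h3 : ∑ x, p x * ∑ y, W x y * log (W x y / q y) ≤ ∑ x, p x * c :=
    Finset.sum_le_sum fun x _ => mul_le_mul_of_nonneg_left (hc x) (hp.1 x)
  rw [← Finset.sum_mul, hp.2, one_mul] at h3
  simp only [div_one, log_one, mul_zero] at h2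
  linarith

open Real in
/-- If all mutual informations are at most `M`, then, up to `ε`, some output distribution is
within divergence `M` of all the rows of the channel. -/
lemma exists_output_dist [Nonempty α] [Nonempty β] (hW : ∀ x y, 0 ≤ W x y)
    (hW1 : ∀ x, ∑ y, W x y = 1) {M ε : ℝ} (hM : ∀ p, IsDist p → mutualInfo p W ≤ M)
    (hε : 0 < ε) :
    ∃ q : β → ℝ, (∀ y, 0 < q y) ∧ ∑ y, q y = 1 ∧
      ∀ x, ∑ y, W x y * log (W x y / q y) ≤ M * log 2 + ε := by
  classical
  set s := exp (-ε) with hs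
  have hs0 : 0 < s := exp_pos _
  have hs1 : s < 1 := by rw [hs, exp_lt_one_iff]; linarith
  have hcard : (0 : ℝ) < Fintype.card β := by exact_mod_cast Fintype.card_pos
  set Q : (β → ℝ) → β → ℝ := fun r y => s * r y + (1 - s) / Fintype.card β with hQ
  have hQpos : ∀ r ∈ stdSimplex ℝ β, ∀ y, 0 < Q r y := fun r hr y =>
    add_pos_of_nonneg_of_pos (mul_nonneg hs0.le (hr.1 y)) (div_pos (by linarith) hcard)
  have hQ1 : ∀ r ∈ stdSimplex ℝ β, ∑ y, Q r y = 1 := by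
    intro r hr
    simp only [hQ, Finset.sum_add_distrib, ← Finset.mul_sum, hr.2, Finset.sum_const,
      Finset.card_univ, nsmul_eq_mul]
    field_simp
    ring
  set f : (β → ℝ) → (α → ℝ) → ℝ := fun r p =>
    ∑ x, p x * ∑ y, W x y * (log (W x y) - log (Q r y)) with hf
  have hlog : ∀ r ∈ stdSimplex ℝ β, ∀ x, ∑ y, W x y * (log (W x y) - log (Q r y))
      = ∑ y, W x y * log (W x y / Q r y) := by
    intro r hr x
    refine Finset.sum_congr rfl fun y _ => ?_
    rcases eq_or_ne (W x y) 0 with h | h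
    · simp [h]
    · rw [log_div h (hQpos r hr y).ne']
  obtain ⟨r, hr, p, hp, hsaddle⟩ : ∃ a ∈ stdSimplex ℝ β, ∃ b ∈ stdSimplex ℝ α,
      IsSaddlePointOn (stdSimplex ℝ β) (stdSimplex ℝ α) f a b := by
    refine Sion.exists_isSaddlePointOn ⟨_, single_mem_stdSimplex ℝ (Classical.arbitrary β)⟩
      (convex_stdSimplex ℝ β) (isCompact_stdSimplex ℝ β) ?_ ?_ (convex_stdSimplex ℝ α)
      ⟨_, single_mem_stdSimplex ℝ (Classical.arbitrary α)⟩ (isCompact_stdSimplex ℝ α) ?_ ?_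
    · intro p _
      refine ContinuousOn.lowerSemicontinuousOn ?_
      refine continuousOn_finsetSum _ fun x _ => continuousOn_const.mul ?_
      refine continuousOn_finsetSum _ fun y _ => continuousOn_const.mul ?_
      refine continuousOn_const.sub (ContinuousOn.log ?_ fun r hr => (hQpos r hr y).ne')
      simp only [hQ]
      fun_prop
    · intro p hp
      refine ConvexOn.quasiconvexOn ⟨convex_stdSimplex ℝ β, ?_⟩
      intro r hr r' hr' a b ha hb hab
      simp only [hf, smul_eq_mul, Finset.mul_sum]
      rw [← Finset.sum_add_distrib]
      refine Finset.sum_le_sum fun x _ => ?_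
      rw [← Finset.sum_add_distrib]
      refine Finset.sum_le_sum fun y _ => ?_
      have hcv := strictConcaveOn_log_Ioi.concaveOn.2 (hQpos r hr y) (hQpos r' hr' y) ha hb hab
      have haff : Q (a • r + b • r') y = a • Q r y + b • Q r' y := by
        obtain rfl : b = 1 - a := by linarith
        simp only [hQ, Pi.add_apply, Pi.smul_apply, smul_eq_mul]
        ring
      rw [← haff] at hcv
      simp only [smul_eq_mul] at hcv
      have h0 : 0 ≤ p x * W x y := mul_nonneg (hp.1 x) (hW x y)
      obtain rfl : b = 1 - a := by linarith
      nlinarith [mul_le_mul_of_nonneg_left hcv h0]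
    · intro r _
      refine Continuous.continuousOn ?_ |>.upperSemicontinuousOn
      simp only [hf]
      fun_prop
    · intro r _
      refine ConcaveOn.quasiconcaveOn ⟨convex_stdSimplex ℝ α, ?_⟩
      intro p _ p' _ a b _ _ _
      simp only [hf, smul_eq_mul, Pi.add_apply, Pi.smul_apply]
      rw [Finset.mul_sum, Finset.mul_sum, ← Finset.sum_add_distrib]
      refine (Finset.sum_congr rfl fun x _ => ?_).le
      ring
  refine ⟨Q r, hQpos r hr, hQ1 r hr, fun x => ?_⟩
  set r' : β → ℝ := fun y => ∑ x, p x * W x y with hr'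
  have hr'mem : r' ∈ stdSimplex ℝ β :=
    ⟨fun y => Finset.sum_nonneg fun x _ => mul_nonneg (hp.1 x) (hW x y),
      sum_output_eq_one hW1 hp⟩
  have h := hsaddle r' hr'mem (Pi.single x 1) (single_mem_stdSimplex ℝ x)
  have hleft : f r (Pi.single x 1) = ∑ y, W x y * log (W x y / Q r y) := by
    rw [← hlog r hr]
    simp [hf, Pi.single_apply]
  have hright : f r' p = ∑ x, p x * ∑ y, W x y * log (W x y / Q r' y) :=
    Finset.sum_congr rfl fun x _ => by rw [hlog r' hr'mem]
  rw [hleft, hright, ← mutualInfo_add_divergence hW hp (hQpos r' hr'mem)] at h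
  have hI : mutualInfo p W * log 2 ≤ M * log 2 :=
    mul_le_mul_of_nonneg_right (hM p hp) (log_pos one_lt_two).le
  have hD : ∑ y, r' y * log (r' y / Q r' y) ≤ ∑ y, r' y * ε := by
    refine Finset.sum_le_sum fun y _ => ?_
    rcases (hr'mem.1 y).eq_or_lt with h0 | h0
    · simp [← h0]
    refine mul_le_mul_of_nonneg_left ?_ h0.le
    rw [log_le_iff_le_exp (div_pos h0 (hQpos r' hr'mem y)), div_le_iff₀ (hQpos r' hr'mem y)]
    have he : exp ε * s = 1 := by rw [hs, ← exp_add]; simp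
    have hrest : 0 ≤ exp ε * ((1 - s) / Fintype.card β) :=
      mul_nonneg (exp_pos _).le (div_pos (by linarith) hcard).le
    calc r' y = exp ε * s * r' y := by rw [he, one_mul]
      _ ≤ exp ε * s * r' y + exp ε * ((1 - s) / Fintype.card β) := by linarith
      _ = exp ε * Q r' y := by simp only [hQ]; ring
  rw [← Finset.sum_mul, hr'mem.2, one_mul] at hD
  linarith

lemma bddAbove_mutualInfo (hW : ∀ x y, 0 ≤ W x y) (hW1 : ∀ x, ∑ y, W x y = 1) :
    BddAbove (Set.range fun p : {p : α → ℝ // IsDist p} => mutualInfo p.1 W) := by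
  set c := ∑ x, |∑ y, W x y * Real.log (W x y / (1 / Fintype.card β))| with hc
  refine ⟨c / Real.log 2, ?_⟩
  rintro _ ⟨⟨p, hp⟩, rfl⟩
  have hβ : Nonempty β := by
    by_contra hβ
    have := sum_output_eq_one hW1 hp
    simp [not_nonempty_iff.1 hβ] at this
  have hcard : (0 : ℝ) < Fintype.card β := by exact_mod_cast Fintype.card_pos
  rw [le_div_iff₀ (Real.log_pos one_lt_two)]
  refine mutualInfo_mul_log_two_le hW hW1 (q := fun _ => 1 / Fintype.card β)
    (fun _ => by positivity) (by simp [hcard.ne']) (fun x => ?_) hp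
  exact (le_abs_self _).trans (Finset.single_le_sum
    (f := fun x => |∑ y, W x y * Real.log (W x y / (1 / Fintype.card β))|)
    (fun _ _ => abs_nonneg _) (Finset.mem_univ x))

lemma isDist_single [DecidableEq α] (x : α) : IsDist (Pi.single x (1 : ℝ)) :=
  single_mem_stdSimplex ℝ x

lemma mutualInfo_single [DecidableEq α] (x : α) : mutualInfo (Pi.single x (1 : ℝ)) W = 0 := by
  refine Finset.sum_eq_zero fun x' _ => Finset.sum_eq_zero fun y _ => ?_
  rcases eq_or_ne x' x with rfl | h
  · rcases eq_or_ne (W x' y) 0 with h | h <;> simp [Pi.single_apply, h]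
  · simp [Pi.single_apply, h]

lemma iSup_mutualInfo_nonneg [Nonempty α] (hW : ∀ x y, 0 ≤ W x y) (hW1 : ∀ x, ∑ y, W x y = 1) :
    0 ≤ ⨆ p : {p : α → ℝ // IsDist p}, mutualInfo p.1 W := by
  classical
  have x := Classical.arbitrary α
  exact (mutualInfo_single (W := W) x).ge.trans
    (le_ciSup (bddAbove_mutualInfo hW hW1) ⟨_, isDist_single x⟩)

end Channel

/-! ### Deletion as an algebra homomorphism -/

/-- The monoid algebra of binary strings; finitely supported measures live in it. -/
abbrev StringAlg := MonoidAlgebra ℝ (FreeMonoid Bool)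

/-- The distribution of the output of the deletion channel on the input string `x`. -/
def delDist (d : ℝ) : FreeMonoid Bool →* StringAlg :=
  FreeMonoid.lift fun b =>
    MonoidAlgebra.single 1 d + MonoidAlgebra.single (FreeMonoid.of b) (1 - d)

/-- The action of the deletion channel on measures on strings. -/
def delHom (d : ℝ) : StringAlg →ₐ[ℝ] StringAlg :=
  MonoidAlgebra.lift ℝ StringAlg (FreeMonoid Bool) (delDist d)

/-- Total mass. -/
def mass : StringAlg →ₐ[ℝ] ℝ := MonoidAlgebra.lift ℝ ℝ (FreeMonoid Bool) 1

lemma mass_eq (w : StringAlg) : mass w = w.coeff.sum fun _ a => a := by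
  simp [mass, MonoidAlgebra.lift_apply]

lemma mass_single (y : FreeMonoid Bool) (a : ℝ) : mass (MonoidAlgebra.single y a) = a := by
  simp [mass]

lemma delDist_of (d : ℝ) (b : Bool) : delDist d (FreeMonoid.of b)
    = MonoidAlgebra.single 1 d + MonoidAlgebra.single (FreeMonoid.of b) (1 - d) := by
  simp [delDist]

lemma delHom_delDist (d d' : ℝ) (x : FreeMonoid Bool) :
    delHom d (delDist d' x) = delDist (1 - (1 - d') * (1 - d)) x := by
  have h : (delHom d : StringAlg →* StringAlg).comp (delDist d')
      = delDist (1 - (1 - d') * (1 - d)) := by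
    refine FreeMonoid.hom_eq fun b => ?_
    simp only [MonoidHom.comp_apply, delDist_of, MonoidHom.coe_coe, map_add, delHom,
      MonoidAlgebra.lift_single, map_one, MonoidAlgebra.one_def, smul_add,
      MonoidAlgebra.smul_single, smul_eq_mul, ← add_assoc, ← MonoidAlgebra.single_add]
    congr 2 <;> ring
  exact DFunLike.congr_fun h x

lemma mass_delDist (d : ℝ) (x : FreeMonoid Bool) : mass (delDist d x) = 1 := by
  have h : (mass : StringAlg →* ℝ).comp (delDist d) = 1 := by
    refine FreeMonoid.hom_eq fun b => ?_
    simp [delDist_of, mass_single]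
  exact DFunLike.congr_fun h x

lemma delDist_of_mul (d : ℝ) (b : Bool) (x : FreeMonoid Bool) :
    delDist d (FreeMonoid.of b * x)
      = d • delDist d x + (1 - d) • (MonoidAlgebra.single (FreeMonoid.of b) 1 * delDist d x) := by
  rw [map_mul, delDist_of, add_mul]
  congr 1
  · have h : (MonoidAlgebra.single 1 d : StringAlg) = d • 1 := by
      rw [MonoidAlgebra.one_def, MonoidAlgebra.smul_single, smul_eq_mul, mul_one]
    rw [h, smul_mul_assoc, one_mul]
  · rw [← smul_mul_assoc, MonoidAlgebra.smul_single, smul_eq_mul, mul_one]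

lemma coeff_mul_nonneg {v w : StringAlg} (hv : ∀ y, 0 ≤ v.coeff y) (hw : ∀ y, 0 ≤ w.coeff y)
    (y : FreeMonoid Bool) : 0 ≤ (v * w).coeff y := by
  classical
  rw [MonoidAlgebra.coeff_mul]
  refine Finset.sum_nonneg fun i _ => Finset.sum_nonneg fun j _ => ?_
  dsimp only
  split_ifs
  exacts [mul_nonneg (hv i) (hw j), le_rfl]

lemma coeff_single_nonneg {a : ℝ} (ha : 0 ≤ a) (x y : FreeMonoid Bool) :
    0 ≤ (MonoidAlgebra.single x a).coeff y := by
  classical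
  rw [MonoidAlgebra.coeff_single, Finsupp.single_apply]
  split_ifs
  exacts [ha, le_rfl]

lemma delDist_nonneg {d : ℝ} (hd0 : 0 ≤ d) (hd1 : d ≤ 1) (x y : FreeMonoid Bool) :
    0 ≤ (delDist d x).coeff y := by
  induction x using FreeMonoid.inductionOn' generalizing y with
  | one =>
    rw [map_one, MonoidAlgebra.one_def]
    exact coeff_single_nonneg zero_le_one _ _
  | of_mul b x ih =>
    rw [delDist_of_mul]
    have h := coeff_mul_nonneg (coeff_single_nonneg zero_le_one (FreeMonoid.of b)) ih y
    simp only [MonoidAlgebra.coeff_add, MonoidAlgebra.coeff_smul, Finsupp.add_apply,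
      Finsupp.smul_apply, smul_eq_mul]
    have := ih y
    have : 0 ≤ 1 - d := by linarith
    positivity

lemma length_le_of_delDist_ne_zero {d : ℝ} {x y : FreeMonoid Bool}
    (h : (delDist d x).coeff y ≠ 0) : y.length ≤ x.length := by
  classical
  induction x using FreeMonoid.inductionOn' generalizing y with
  | one =>
    rw [map_one, MonoidAlgebra.one_def, MonoidAlgebra.coeff_single, Finsupp.single_apply] at h
    simp_all
  | of_mul b x ih =>
    rw [FreeMonoid.length_mul, FreeMonoid.length_of]
    by_contra! hlt
    apply h
    have h1 : (delDist d x).coeff y = 0 := by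
      by_contra hne
      have := ih hne
      omega
    rw [delDist_of_mul]
    simp only [MonoidAlgebra.coeff_add, MonoidAlgebra.coeff_smul, Finsupp.add_apply,
      Finsupp.smul_apply, smul_eq_mul, h1, MonoidAlgebra.coeff_mul, MonoidAlgebra.coeff_single]
    rw [Finsupp.sum_single_index (by simp), Finsupp.sum, Finset.sum_eq_zero]
    · simp
    · intro z hz
      rw [if_neg]
      rintro rfl
      have := ih (Finsupp.mem_support_iff.1 hz)
      rw [FreeMonoid.length_mul, FreeMonoid.length_of] at hlt
      omega

/-- Expected length, as a linear functional. -/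
def meanLength : StringAlg →+ ℝ where
  toFun w := w.coeff.sum fun y a => a * (y.length : ℝ)
  map_zero' := by simp
  map_add' v w := by
    rw [MonoidAlgebra.coeff_add]
    exact Finsupp.sum_add_index' (by simp) (by intros; ring)

lemma meanLength_eq (w : StringAlg) :
    meanLength w = w.coeff.sum fun y a => a * (y.length : ℝ) := rfl

lemma meanLength_smul (a : ℝ) (w : StringAlg) : meanLength (a • w) = a * meanLength w := by
  rw [meanLength_eq, meanLength_eq, MonoidAlgebra.coeff_smul,
    Finsupp.sum_smul_index (by simp), Finsupp.mul_sum]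
  simp only [mul_assoc]

lemma meanLength_single (y : FreeMonoid Bool) (a : ℝ) :
    meanLength (MonoidAlgebra.single y a) = a * y.length := by
  rw [meanLength_eq, MonoidAlgebra.coeff_single, Finsupp.sum_single_index (by simp)]

lemma meanLength_of_mul (b : Bool) (w : StringAlg) :
    meanLength (MonoidAlgebra.single (FreeMonoid.of b) 1 * w) = mass w + meanLength w := by
  induction w using MonoidAlgebra.induction_linear with
  | zero => simp
  | add v w hv hw => rw [mul_add, map_add, map_add, map_add, hv, hw]; ring
  | single y a =>
    rw [MonoidAlgebra.single_mul_single, meanLength_single, meanLength_single, mass_single,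
      FreeMonoid.length_mul, FreeMonoid.length_of]
    push_cast
    ring

lemma meanLength_delDist (d : ℝ) (x : FreeMonoid Bool) :
    meanLength (delDist d x) = (1 - d) * x.length := by
  induction x using FreeMonoid.inductionOn' with
  | one => rw [map_one, MonoidAlgebra.one_def, meanLength_single]; simp
  | of_mul b x ih =>
    rw [delDist_of_mul, map_add, meanLength_smul, meanLength_smul, meanLength_of_mul, ih,
      mass_delDist, FreeMonoid.length_mul, FreeMonoid.length_of]
    push_cast
    ring

/-- Relative entropy is subadditive under convolution. -/
lemma relEnt_mul_le {v w q r : StringAlg} (hv : ∀ y, 0 ≤ v.coeff y) (hw : ∀ y, 0 ≤ w.coeff y)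
    (hq : ∀ y, 0 ≤ q.coeff y) (hr : ∀ y, 0 ≤ r.coeff y) (hv1 : mass v = 1) (hw1 : mass w = 1)
    (hvq : ∀ y, v.coeff y ≠ 0 → 0 < q.coeff y) (hwr : ∀ y, w.coeff y ≠ 0 → 0 < r.coeff y) :
    relEnt (v * w).coeff (q * r).coeff ≤ relEnt v.coeff q.coeff + relEnt w.coeff r.coeff := by
  classical
  set s := v.coeff.support ×ˢ w.coeff.support with hs
  have hmul : ∀ (f g : StringAlg) (y : FreeMonoid Bool), (f * g).coeff y
      = ∑ i ∈ f.coeff.support ×ˢ g.coeff.support with i.1 * i.2 = y,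
        f.coeff i.1 * g.coeff i.2 := by
    intro f g y
    rw [MonoidAlgebra.coeff_mul, Finset.sum_filter, Finset.sum_product]
    rfl
  have hle := relEnt_le_of_map s (fun i => i.1 * i.2) (fun i => v.coeff i.1 * w.coeff i.2)
    (fun i => q.coeff i.1 * r.coeff i.2) (fun i _ => mul_nonneg (hv _) (hw _))
    (fun i _ => mul_nonneg (hq _) (hr _)) ?_ (v * w).coeff (q * r).coeff (hmul v w) ?_
  · refine hle.trans_eq ?_
    have hterm : ∀ i ∈ s, v.coeff i.1 * w.coeff i.2
        * Real.log (v.coeff i.1 * w.coeff i.2 / (q.coeff i.1 * r.coeff i.2))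
        = v.coeff i.1 * Real.log (v.coeff i.1 / q.coeff i.1) * w.coeff i.2
          + v.coeff i.1 * (w.coeff i.2 * Real.log (w.coeff i.2 / r.coeff i.2)) := by
      intro i hi
      rw [hs, Finset.mem_product, Finsupp.mem_support_iff, Finsupp.mem_support_iff] at hi
      rw [mul_div_mul_comm, Real.log_mul (div_ne_zero hi.1 (hvq _ hi.1).ne')
        (div_ne_zero hi.2 (hwr _ hi.2).ne')]
      ring
    rw [mass_eq, Finsupp.sum] at hv1 hw1
    rw [Finset.sum_congr rfl hterm, Finset.sum_add_distrib, hs, Finset.sum_product,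
      Finset.sum_product]
    simp only [← Finset.mul_sum, hw1, mul_one, ← Finset.sum_mul, hv1, one_mul]
    rfl
  · intro i hi h
    rw [hs, Finset.mem_product, Finsupp.mem_support_iff, Finsupp.mem_support_iff] at hi
    exact absurd h (mul_pos (hvq _ hi.1) (hwr _ hi.2)).ne'
  · intro y
    rw [hmul q r]
    refine Finset.sum_le_sum_of_subset_of_nonneg ?_ fun i _ _ => mul_nonneg (hq _) (hr _)
    refine Finset.filter_subset_filter _ (Finset.product_subset_product ?_ ?_)
    · exact fun y hy => Finsupp.mem_support_iff.2 (hvq y (Finsupp.mem_support_iff.1 hy)).ne'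
    · exact fun y hy => Finsupp.mem_support_iff.2 (hwr y (Finsupp.mem_support_iff.1 hy)).ne'

/-! ### Divergence bounds for the deletion channel -/

/-- Some distribution is within divergence `c` of all the output distributions of the deletion
channel on inputs of length `n`. -/
def DivBound (d : ℝ) (n : ℕ) (c : ℝ) : Prop :=
  ∃ q : StringAlg, (∀ y, 0 ≤ q.coeff y) ∧ mass q = 1 ∧ (∀ y, y.length ≤ n → 0 < q.coeff y) ∧
    ∀ x, x.length = n → relEnt (delDist d x).coeff q.coeff ≤ c

lemma DivBound.mono {d : ℝ} {n : ℕ} {c c' : ℝ} (h : DivBound d n c) (hc : c ≤ c') :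
    DivBound d n c' := by
  obtain ⟨q, h0, h1, hpos, hle⟩ := h
  exact ⟨q, h0, h1, hpos, fun x hx => (hle x hx).trans hc⟩

lemma exists_mul_of_length_le {m n : ℕ} (y : FreeMonoid Bool) (hy : y.length ≤ m + n) :
    ∃ a b, y = a * b ∧ a.length ≤ m ∧ b.length ≤ n ∧
      (y.length = m + n → a.length = m ∧ b.length = n) := by
  refine ⟨FreeMonoid.ofList (y.toList.take m), FreeMonoid.ofList (y.toList.drop m), ?_, ?_⟩
  · rw [← FreeMonoid.ofList_append, List.take_append_drop, FreeMonoid.ofList_toList]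
  · change y.toList.length ≤ m + n at hy
    change (y.toList.take m).length ≤ m ∧ (y.toList.drop m).length ≤ n ∧
      (y.toList.length = m + n → (y.toList.take m).length = m ∧ (y.toList.drop m).length = n)
    rw [List.length_take, List.length_drop]
    omega

lemma coeff_mul_pos {v w : StringAlg} (hv : ∀ y, 0 ≤ v.coeff y) (hw : ∀ y, 0 ≤ w.coeff y)
    {a b : FreeMonoid Bool} (ha : 0 < v.coeff a) (hb : 0 < w.coeff b) :
    0 < (v * w).coeff (a * b) := by
  classical
  have hterm : ∀ i j, 0 ≤ if i * j = a * b then v.coeff i * w.coeff j else 0 := by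
    intro i j
    split_ifs
    exacts [mul_nonneg (hv i) (hw j), le_rfl]
  rw [MonoidAlgebra.coeff_mul]
  refine Finset.sum_pos' (fun i _ => Finset.sum_nonneg fun j _ => hterm i j)
    ⟨a, Finsupp.mem_support_iff.2 ha.ne', ?_⟩
  refine Finset.sum_pos' (fun j _ => hterm a j) ⟨b, Finsupp.mem_support_iff.2 hb.ne', ?_⟩
  simpa using mul_pos ha hb

lemma DivBound.add {d : ℝ} (hd0 : 0 ≤ d) (hd1 : d ≤ 1) {m n : ℕ} {c c' : ℝ}
    (h : DivBound d m c) (h' : DivBound d n c') : DivBound d (m + n) (c + c') := by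
  obtain ⟨q, hq0, hq1, hqpos, hq⟩ := h
  obtain ⟨r, hr0, hr1, hrpos, hr⟩ := h'
  refine ⟨q * r, coeff_mul_nonneg hq0 hr0, by rw [map_mul, hq1, hr1, one_mul], ?_, ?_⟩
  · intro y hy
    obtain ⟨a, b, rfl, ha, hb, -⟩ := exists_mul_of_length_le y hy
    exact coeff_mul_pos hq0 hr0 (hqpos a ha) (hrpos b hb)
  · intro x hx
    obtain ⟨a, b, rfl, -, -, hab⟩ := exists_mul_of_length_le x hx.le
    obtain ⟨ha, hb⟩ := hab hx
    rw [map_mul]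
    refine (relEnt_mul_le (delDist_nonneg hd0 hd1 a) (delDist_nonneg hd0 hd1 b) hq0 hr0
      (mass_delDist d a) (mass_delDist d b) ?_ ?_).trans (add_le_add (hq a ha) (hr b hb))
    · exact fun y hy => hqpos y ((length_le_of_delDist_ne_zero hy).trans_eq ha)
    · exact fun y hy => hrpos y ((length_le_of_delDist_ne_zero hy).trans_eq hb)

/-- A divergence bound at one length gives a bound with the same slope at all lengths. -/
lemma DivBound.exists_affine {d : ℝ} (hd0 : 0 ≤ d) (hd1 : d ≤ 1) {n : ℕ} (hn : 0 < n) {c : ℝ}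
    (h : DivBound d n (n * c)) (hall : ∀ r, ∃ c', DivBound d r c') :
    ∃ K, ∀ k : ℕ, DivBound d k (k * c + K) := by
  choose e he using hall
  refine ⟨∑ r ∈ Finset.range n, |e r - r * c|, fun k => ?_⟩
  have hmul : ∀ j r : ℕ, DivBound d (n * j + r) (n * j * c + e r) := by
    intro j r
    induction j with
    | zero => simpa using he r
    | succ j ih =>
      have := h.add hd0 hd1 ih
      rw [show n * (j + 1) + r = n + (n * j + r) by ring]
      refine this.mono (le_of_eq ?_)
      push_cast
      ring
  have hk := hmul (k / n) (k % n)
  rw [Nat.div_add_mod] at hk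
  refine hk.mono ?_
  have hr : |e (k % n) - (k % n : ℕ) * c| ≤ ∑ r ∈ Finset.range n, |e r - r * c| :=
    Finset.single_le_sum (f := fun r : ℕ => |e r - r * c|) (fun _ _ => abs_nonneg _)
      (Finset.mem_range.2 (Nat.mod_lt k hn))
  have hle := (le_abs_self _).trans hr
  have hcast : (k : ℝ) = n * (k / n : ℕ) + (k % n : ℕ) := by
    exact_mod_cast (Nat.div_add_mod k n).symm
  calc _ = (n * (k / n : ℕ) + (k % n : ℕ)) * c + (e (k % n) - (k % n : ℕ) * c) := by ring
    _ ≤ _ := by rw [← hcast]; linarith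

lemma coeff_delHom (d : ℝ) (v : StringAlg) :
    (delHom d v).coeff = ∑ z ∈ v.coeff.support, v.coeff z • (delDist d z).coeff := by
  rw [delHom, MonoidAlgebra.lift_apply, Finsupp.sum, MonoidAlgebra.coeff_sum]
  rfl

/-- Cascading a deletion channel with parameter `d'` and one with parameter `d`. -/
lemma DivBound.cascade {d d' : ℝ} (hd0 : 0 ≤ d) (hd1 : d ≤ 1) (hd0' : 0 ≤ d') (hd1' : d' ≤ 1)
    {c K : ℝ} (h : ∀ k : ℕ, DivBound d k (k * c + K)) (N : ℕ) :
    DivBound (1 - (1 - d') * (1 - d)) N (N * ((1 - d') * c) + (K + Real.log (N + 1))) := by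
  choose q hq0 hq1 hqpos hq using h
  have hN : (0 : ℝ) < N + 1 := by positivity
  set Q : StringAlg := ∑ k ∈ Finset.range (N + 1), ((N + 1 : ℝ)⁻¹) • q k with hQ
  have hQc : ∀ y, Q.coeff y = ∑ k ∈ Finset.range (N + 1), (N + 1 : ℝ)⁻¹ * (q k).coeff y := by
    intro y
    rw [hQ, MonoidAlgebra.coeff_sum, Finsupp.finsetSum_apply]
    rfl
  have hQle : ∀ k ≤ N, ∀ y, (q k).coeff y ≤ (N + 1) * Q.coeff y := by
    intro k hk y
    rw [hQc, ← Finset.mul_sum, mul_inv_cancel_left₀ hN.ne']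
    exact Finset.single_le_sum (f := fun k => (q k).coeff y) (fun i _ => hq0 i y)
      (Finset.mem_range.2 (Nat.lt_succ_of_le hk))
  have hQ0 : ∀ y, 0 ≤ Q.coeff y := fun y => by
    rw [hQc]
    exact Finset.sum_nonneg fun k _ => mul_nonneg (inv_nonneg.2 hN.le) (hq0 k y)
  have hQpos : ∀ y, y.length ≤ N → 0 < Q.coeff y := fun y hy =>
    pos_of_mul_pos_right ((hqpos N y hy).trans_le (hQle N le_rfl y)) hN.le
  refine ⟨Q, hQ0, ?_, hQpos, ?_⟩
  · rw [hQ, map_sum]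
    simp only [map_smul, hq1, smul_eq_mul, mul_one, Finset.sum_const, Finset.card_range,
      nsmul_eq_mul]
    push_cast
    exact mul_inv_cancel₀ hN.ne'
  intro x hx
  set v := delDist d' x with hv
  have hv0 : ∀ z, 0 ≤ v.coeff z := delDist_nonneg hd0' hd1' x
  have hv1 : ∑ z ∈ v.coeff.support, v.coeff z = 1 := by
    rw [← mass_delDist d' x, mass_eq]
    rfl
  have hvlen : ∀ z ∈ v.coeff.support, z.length ≤ N := fun z hz =>
    (length_le_of_delDist_ne_zero (Finsupp.mem_support_iff.1 hz)).trans_eq hx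
  have hmean : ∑ z ∈ v.coeff.support, v.coeff z * (z.length : ℝ) = (1 - d') * N := by
    rw [← hx, ← meanLength_delDist, meanLength_eq]
    rfl
  rw [← delHom_delDist, coeff_delHom]
  refine (relEnt_sum_le _ _ _ _ (fun z _ => hv0 z) hv1
    (fun z _ => delDist_nonneg hd0 hd1 z) hQ0 ?_).trans ?_
  · exact fun z hz y hy => hQpos y ((length_le_of_delDist_ne_zero hy).trans (hvlen z hz))
  calc _ ≤ ∑ z ∈ v.coeff.support, v.coeff z * (z.length * c + K + Real.log (N + 1)) := by
        refine Finset.sum_le_sum fun z hz => mul_le_mul_of_nonneg_left ?_ (hv0 z)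
        refine (relEnt_le_add_log _ (q z.length).coeff _ hN (delDist_nonneg hd0 hd1 z) ?_ ?_
          (hQle _ (hvlen z hz))).trans (add_le_add_left (hq _ z rfl) _)
        · rw [← mass_eq, mass_delDist]
        · exact fun y hy => hqpos _ y (length_le_of_delDist_ne_zero hy)
    _ = (∑ z ∈ v.coeff.support, v.coeff z * (z.length : ℝ)) * c
          + (∑ z ∈ v.coeff.support, v.coeff z) * (K + Real.log (N + 1)) := by
        rw [Finset.sum_mul, Finset.sum_mul, ← Finset.sum_add_distrib]
        exact Finset.sum_congr rfl fun z _ => by ring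
    _ = _ := by rw [hmean, hv1]; ring

/-! ### Comparison with the channel matrix -/

/-- An output of the channel, seen as a string. -/
def outString {n : ℕ} (y : DelOut n) : FreeMonoid Bool := FreeMonoid.ofList (List.ofFn y.2)

lemma length_outString {n : ℕ} (y : DelOut n) : (outString y).length = y.1 :=
  List.length_ofFn

lemma outString_injective (n : ℕ) : Function.Injective (outString (n := n)) := by
  rintro ⟨k, y⟩ ⟨k', y'⟩ h
  obtain rfl : k = k' := by
    have := congrArg FreeMonoid.length h
    rw [length_outString, length_outString] at this
    exact Fin.ext this
  have : y = y' := List.ofFn_injective h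
  rw [this]

lemma exists_outString {n : ℕ} (y : FreeMonoid Bool) (hy : y.length ≤ n) :
    ∃ z : DelOut n, outString z = y :=
  ⟨⟨⟨y.toList.length, Nat.lt_succ_of_le hy⟩, fun i => y.toList.get i⟩, by
    change FreeMonoid.ofList (List.ofFn y.toList.get) = y
    rw [List.ofFn_get, FreeMonoid.ofList_toList]⟩

lemma delDist_map_eq_sum (d : ℝ) {ι : Type*} [DecidableEq ι] (x : ι → Bool) (l : List ι)
    (hl : l.Nodup) : delDist d (FreeMonoid.ofList (l.map x))
      = ∑ S ∈ l.toFinset.powerset, MonoidAlgebra.single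
          (FreeMonoid.ofList ((l.filter (· ∈ S)).map x))
          ((1 - d) ^ S.card * d ^ (l.length - S.card)) := by
  induction l with
  | nil => simp [MonoidAlgebra.one_def]
  | cons i l ih =>
    rw [List.nodup_cons] at hl
    have hi : i ∉ l.toFinset := by simpa using hl.1
    rw [List.map_cons, FreeMonoid.ofList_cons, map_mul, delDist_of, ih hl.2, List.toFinset_cons,
      Finset.sum_powerset_insert hi, add_mul, Finset.mul_sum, Finset.mul_sum]
    congr 1
    · refine Finset.sum_congr rfl fun S hS => ?_
      rw [Finset.mem_powerset] at hS
      have hiS : i ∉ S := fun h => hi (hS h)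
      have hcard : S.card ≤ l.length := (Finset.card_le_card hS).trans l.toFinset_card_le
      rw [MonoidAlgebra.single_mul_single, one_mul, List.filter_cons_of_neg (by simpa using hiS),
        List.length_cons, Nat.succ_sub hcard, pow_succ]
      congr 1
      ring
    · refine Finset.sum_congr rfl fun S hS => ?_
      rw [Finset.mem_powerset] at hS
      have hiS : i ∉ S := fun h => hi (hS h)
      rw [MonoidAlgebra.single_mul_single, List.filter_cons_of_pos (by simp),
        Finset.card_insert_of_notMem hiS, List.length_cons, Nat.add_sub_add_right, List.map_cons,
        FreeMonoid.ofList_cons]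
      have hfilter : l.filter (· ∈ insert i S) = l.filter (· ∈ S) := by
        refine List.filter_congr fun j hj => ?_
        have : j ≠ i := fun h => hl.1 (h ▸ hj)
        simp [this]
      rw [hfilter]
      congr 1
      ring

lemma outString_restrictSub {n : ℕ} (x : Fin n → Bool) (S : Finset (Fin n)) :
    outString (restrictSub x S)
      = FreeMonoid.ofList (((List.finRange n).filter (· ∈ S)).map x) := by
  have hlist : List.ofFn (S.orderEmbOfFin rfl) = (List.finRange n).filter (· ∈ S) := by
    refine List.Perm.eq_of_pairwise (le := (· ≤ ·)) (fun a b _ _ => le_antisymm) ?_ ?_ ?_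
    · exact (List.pairwise_ofFn.2 fun i j hij => (S.orderEmbOfFin rfl).monotone hij.le)
    · exact ((List.pairwise_le_finRange n).filter _)
    · rw [List.perm_ext_iff_of_nodup
        (List.nodup_ofFn.2 (S.orderEmbOfFin rfl).injective) ((List.nodup_finRange n).filter _)]
      intro a
      have h := Set.ext_iff.1 (S.range_orderEmbOfFin rfl) a
      rw [List.mem_ofFn]
      simpa only [List.mem_filter, List.mem_finRange, true_and, decide_eq_true_eq, Set.mem_range,
        Finset.mem_coe] using h
  rw [← hlist, List.map_ofFn]
  rfl

lemma delW_eq_coeff {n : ℕ} (d : ℝ) (x : Fin n → Bool) (y : DelOut n) :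
    delW d x y = (delDist d (FreeMonoid.ofList (List.ofFn x))).coeff (outString y) := by
  classical
  rw [List.ofFn_eq_map, delDist_map_eq_sum d x _ (List.nodup_finRange n),
    MonoidAlgebra.coeff_sum, Finsupp.finsetSum_apply, delW]
  have huniv : (List.finRange n).toFinset.powerset = Finset.univ := by
    ext S
    simp
  rw [huniv]
  refine Finset.sum_congr rfl fun S _ => ?_
  rw [← outString_restrictSub, MonoidAlgebra.coeff_single, Finsupp.single_apply,
    List.length_finRange]
  simp only [(outString_injective n).eq_iff]

lemma sum_support_delDist {n : ℕ} (d : ℝ) (x : Fin n → Bool) (g : FreeMonoid Bool → ℝ → ℝ)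
    (hg : ∀ y, g y 0 = 0) :
    (delDist d (FreeMonoid.ofList (List.ofFn x))).coeff.sum g
      = ∑ y : DelOut n, g (outString y) (delW d x y) := by
  classical
  rw [Finsupp.sum_of_support_subset (s := Finset.univ.map ⟨_, outString_injective n⟩) _ _ _
    (fun y _ => hg y), Finset.sum_map]
  · simp only [Function.Embedding.coeFn_mk, delW_eq_coeff]
  · intro y hy
    have hlen := length_le_of_delDist_ne_zero (Finsupp.mem_support_iff.1 hy)
    obtain ⟨z, rfl⟩ := exists_outString (n := n) y
      (hlen.trans_eq (List.length_ofFn (f := x)))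
    simp

section

variable {n : ℕ} {d : ℝ}

lemma delW_nonneg (hd0 : 0 ≤ d) (hd1 : d ≤ 1) (x : Fin n → Bool) (y : DelOut n) :
    0 ≤ delW d x y := by
  rw [delW_eq_coeff]
  exact delDist_nonneg hd0 hd1 _ _

lemma sum_delW (d : ℝ) (x : Fin n → Bool) : ∑ y, delW d x y = 1 := by
  rw [← sum_support_delDist d x (fun _ a => a) (fun _ => rfl), ← mass_eq, mass_delDist]

lemma relEnt_delDist (d : ℝ) (x : Fin n → Bool) (q : FreeMonoid Bool → ℝ) :
    relEnt (delDist d (FreeMonoid.ofList (List.ofFn x))).coeff q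
      = ∑ y, delW d x y * Real.log (delW d x y / q (outString y)) :=
  sum_support_delDist d x (fun y a => a * Real.log (a / q y)) (by simp)

lemma DivBound.iSup_mutualInfo_le (hd0 : 0 ≤ d) (hd1 : d ≤ 1) {c : ℝ} (h : DivBound d n c) :
    (⨆ p : {p : (Fin n → Bool) → ℝ // IsDist p}, mutualInfo p.1 (delW d)) ≤ c / Real.log 2 := by
  classical
  obtain ⟨q, hq0, hq1, hqpos, hq⟩ := h
  have : Nonempty {p : (Fin n → Bool) → ℝ // IsDist p} := ⟨⟨_, isDist_single fun _ => false⟩⟩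
  refine ciSup_le fun p => ?_
  rw [le_div_iff₀ (Real.log_pos one_lt_two)]
  refine mutualInfo_mul_log_two_le (delW_nonneg hd0 hd1) (sum_delW d)
    (q := fun y => q.coeff (outString y)) (fun y => hqpos _ ?_) ?_ (fun x => ?_) p.2
  · rw [length_outString]
    exact Nat.le_of_lt_succ y.1.2
  · rw [mass_eq] at hq1
    rw [← hq1, Finsupp.sum, ← Finset.sum_image (f := fun y => q.coeff y)
      (fun y _ z _ hyz => outString_injective n hyz)]
    refine (Finset.sum_le_sum_of_subset_of_nonneg (Finset.subset_union_left
      (s₂ := q.coeff.support)) fun y _ _ => hq0 y).trans_eq ?_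
    refine (Finset.sum_subset Finset.subset_union_right fun y _ hy => ?_).symm
    exact Finsupp.notMem_support_iff.1 hy
  · rw [← relEnt_delDist d x]
    exact hq _ (List.length_ofFn (f := x))

lemma divBound_iSup_mutualInfo (hd0 : 0 ≤ d) (hd1 : d ≤ 1) (n : ℕ) {ε : ℝ} (hε : 0 < ε) :
    DivBound d n
      ((⨆ p : {p : (Fin n → Bool) → ℝ // IsDist p}, mutualInfo p.1 (delW d)) * Real.log 2
        + ε) := by
  classical
  have : Nonempty (DelOut n) := ⟨⟨0, fun _ => false⟩⟩
  obtain ⟨q, hqpos, hq1, hq⟩ := exists_output_dist (delW_nonneg hd0 hd1) (sum_delW (n := n) d)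
    (fun p hp => le_ciSup (bddAbove_mutualInfo (delW_nonneg hd0 hd1) (sum_delW (n := n) d))
      ⟨p, hp⟩) hε
  set Q : StringAlg := ∑ y, MonoidAlgebra.single (outString y) (q y) with hQ
  have hQc : ∀ y, Q.coeff (outString y) = q y := by
    intro y
    rw [hQ, MonoidAlgebra.coeff_sum, Finsupp.finsetSum_apply]
    simp [Finsupp.single_apply, (outString_injective n).eq_iff]
  refine ⟨Q, fun y => ?_, ?_, fun y hy => ?_, fun x hx => ?_⟩
  · rw [hQ, MonoidAlgebra.coeff_sum, Finsupp.finsetSum_apply]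
    exact Finset.sum_nonneg fun z _ => coeff_single_nonneg (hqpos z).le _ _
  · rw [hQ, map_sum]
    simp only [mass_single, hq1]
  · obtain ⟨z, rfl⟩ := exists_outString y hy
    rw [hQc]
    exact hqpos z
  · subst hx
    have h := relEnt_delDist d (fun i : Fin x.length => x.toList.get i) Q.coeff
    change relEnt (delDist d (FreeMonoid.ofList (List.ofFn x.toList.get))).coeff _ = _ at h
    rw [List.ofFn_get, FreeMonoid.ofList_toList] at h
    rw [h]
    simp only [hQc]
    exact hq _

lemma Cn_nonneg (hd0 : 0 ≤ d) (hd1 : d ≤ 1) (n : ℕ) : 0 ≤ Cn n d :=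
  mul_nonneg (by positivity) (iSup_mutualInfo_nonneg (delW_nonneg hd0 hd1) (sum_delW d))

lemma C_le_Cn (hd0 : 0 ≤ d) (hd1 : d ≤ 1) (hn : 1 ≤ n) : C d ≤ Cn n d :=
  ciInf_le (f := fun m : {m : ℕ // 1 ≤ m} => Cn m d)
    ⟨0, by rintro _ ⟨m, rfl⟩; exact Cn_nonneg hd0 hd1 m⟩ ⟨n, hn⟩

lemma C_nonneg (hd0 : 0 ≤ d) (hd1 : d ≤ 1) : 0 ≤ C d :=
  Real.iInf_nonneg fun m => Cn_nonneg hd0 hd1 m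

end

/-! ### Monotonicity of the capacity per kept bit -/

open Filter Topology in
lemma C_cascade_le_mul_Cn {d d' : ℝ} (hd0 : 0 ≤ d) (hd1 : d ≤ 1) (hd0' : 0 ≤ d') (hd1' : d' ≤ 1)
    {n : ℕ} (hn : 1 ≤ n) : C (1 - (1 - d') * (1 - d)) ≤ (1 - d') * Cn n d := by
  have hlog2 : 0 < Real.log 2 := Real.log_pos one_lt_two
  have hnpos : (0 : ℝ) < n := by exact_mod_cast hn
  have he0 : 0 ≤ 1 - (1 - d') * (1 - d) := by nlinarith
  have he1 : 1 - (1 - d') * (1 - d) ≤ 1 := by nlinarith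
  refine le_of_forall_pos_le_add fun ε hε => ?_
  have hbound : DivBound d n (n * (Cn n d * Real.log 2 + ε * Real.log 2)) := by
    refine (divBound_iSup_mutualInfo hd0 hd1 n (ε := n * (ε * Real.log 2))
      (by positivity)).mono (le_of_eq ?_)
    rw [Cn]
    field_simp
  obtain ⟨K, hK⟩ := hbound.exists_affine hd0 hd1 hn
    fun r => ⟨_, divBound_iSup_mutualInfo hd0 hd1 r one_pos⟩
  have hN : ∀ N : ℕ, 1 ≤ N → C (1 - (1 - d') * (1 - d)) ≤ (1 - d') * (Cn n d + ε)
      + (K / N + Real.log (N + 1) / N) / Real.log 2 := by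
    intro N hN
    have hNpos : (0 : ℝ) < N := by exact_mod_cast hN
    refine (C_le_Cn he0 he1 hN).trans ?_
    have h := (DivBound.cascade hd0 hd1 hd0' hd1' hK N).iSup_mutualInfo_le he0 he1
    rw [Cn]
    refine (mul_le_mul_of_nonneg_left h (by positivity)).trans_eq ?_
    field_simp
  have hlim : Tendsto (fun N : ℕ => (1 - d') * (Cn n d + ε)
      + (K / N + Real.log (N + 1) / N) / Real.log 2) atTop (𝓝 ((1 - d') * (Cn n d + ε)
      + (0 + 0) / Real.log 2)) := by
    refine tendsto_const_nhds.add (((tendsto_const_div_atTop_nhds_zero_nat K).add ?_).div_const _)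
    have h1 : Tendsto (fun N : ℕ => Real.log ((N : ℝ) + 1) / ((1 : ℝ) * ((N : ℝ) + 1) + (-1)))
        atTop (𝓝 0) := by
      have h := Real.tendsto_pow_log_div_mul_add_atTop 1 (-1) 1 one_ne_zero
      simp only [pow_one] at h
      exact h.comp ((tendsto_natCast_atTop_atTop (R := ℝ)).atTop_add tendsto_const_nhds)
    refine h1.congr fun N => ?_
    ring_nf
  have h := ge_of_tendsto hlim (eventually_atTop.2 ⟨1, hN⟩)
  have : (1 - d') * ε ≤ ε := by nlinarith
  simp only [add_zero, zero_div] at h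
  linarith

/-- The capacity per kept bit does not increase with the deletion probability. -/
lemma antitoneOn_C_div : AntitoneOn (fun d : ℝ => C d / (1 - d)) (Set.Ioo 0 1) := by
  intro d hd e he hde
  have hd1 : 0 < 1 - d := by linarith [hd.2]
  have he1 : 0 < 1 - e := by linarith [he.2]
  have : Nonempty {m : ℕ // 1 ≤ m} := ⟨⟨1, le_rfl⟩⟩
  set d' := 1 - (1 - e) / (1 - d) with hd'
  have hratio : (1 - e) / (1 - d) ≤ 1 := (div_le_one hd1).2 (by linarith)
  have hratio0 : 0 < (1 - e) / (1 - d) := div_pos he1 hd1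
  have hcomp : 1 - (1 - d') * (1 - d) = e := by
    rw [hd']
    field_simp
    ring
  have hsub : 1 - d' = (1 - e) / (1 - d) := by rw [hd']; ring
  have h : C e * (1 - d) / (1 - e) ≤ C d := by
    refine le_ciInf fun m => ?_
    have hm := C_cascade_le_mul_Cn hd.1.le hd.2.le (d' := d') (by linarith) (by linarith) m.2
    rw [hcomp, hsub] at hm
    rw [div_le_iff₀ he1]
    rw [div_mul_eq_mul_div, le_div_iff₀ hd1] at hm
    linarith
  change C e / (1 - e) ≤ C d / (1 - d)
  rw [le_div_iff₀ hd1]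
  linarith [div_mul_eq_mul_div (C e) (1 - e) (1 - d)]

/-- The limit `lim_{d→1⁻} C(d)/(1−d)` (along `d` tending to `1` from the
left within `(0,1)`) exists and equals `inf_{d∈(0,1)} C(d)/(1−d)`. -/
theorem tendsto_C_ratio_to_inf :
    Filter.Tendsto (fun d : ℝ => C d / (1 - d)) (nhdsWithin 1 (Set.Ioo 0 1))
      (nhds (⨅ d : Set.Ioo (0 : ℝ) 1, C d / (1 - (d : ℝ)))) := by
  have h := antitoneOn_C_div.tendsto_nhdsWithin_Ioo_left (x := 1) (y := 0) ⟨1 / 2, by norm_num⟩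
    ⟨0, by
      rintro _ ⟨d, hd, rfl⟩
      exact div_nonneg (C_nonneg hd.1.le hd.2.le) (by linarith [hd.2])⟩
  rw [sInf_image'] at h
  exact h.mono_left (nhdsWithin_mono _ fun d hd => hd.2)
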